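/- Let n ≥ 2. If 𝒜 satisfies (H) for (i,j) and ℬ satisfies (H) for (k,l), then the convolution product 𝒜∗ℬ satisfies (H) for (ik, lcm(j, i·l)), and therefore also satisfies (H) for (ik, j·l). -/

import Mathlib

namespace Folding

noncomputable section

open Set

/-- Points of `ℝ^n` with the euclidean distance. -/
abbrev Pt (n : ℕ) := EuclideanSpace ℝ (Fin n)

/-- `p` is a point of the lattice `ℤ^n`. -/
def latt {n : ℕ} (p : Pt n) : Prop := ∀ i, ∃ m : ℤ, p i = (m : ℝ)

/-- `p` belongs to `m·ℤ^n`. -/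
def inLat {n : ℕ} (m : ℕ) (p : Pt n) : Prop := ∀ i, ∃ c : ℤ, p i = (m : ℝ) * (c : ℝ)

/-- The canonical basis vector `e_i`. -/
def uvec (n : ℕ) (i : Fin n) : Pt n := EuclideanSpace.single i (1 : ℝ)

/-- `u` belongs to `E = {e_1, -e_1, …, e_n, -e_n}`. -/
def IsDir {n : ℕ} (u : Pt n) : Prop := ∃ i, u = uvec n i ∨ u = -uvec n i

/-- A (nonoriented) lattice segment `[x, x + e_i]`, as an unordered pair of endpoints. -/
def IsSeg {n : ℕ} (S : Sym2 (Pt n)) : Prop := ∃ x i, latt x ∧ S = s(x, x + uvec n i)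

/-- A curve: a sequence of segments, indexed by an interval of `ℤ` (finite, ℕ-like or ℤ-like),
recorded through its sequence of vertices; two consecutive segments have exactly one common
endpoint, and the common endpoints with the preceding and the following segments differ
(`noback`). -/
structure Curve (n : ℕ) where
  dom : Set ℤ
  ordConn : dom.OrdConnected
  nontriv : ∃ i, i ∈ dom ∧ i + 1 ∈ dom
  v : ℤ → Pt n
  lattice : ∀ i ∈ dom, latt (v i)
  step : ∀ i : ℤ, i ∈ dom → i + 1 ∈ dom →
    ∃ j, v (i + 1) = v i + uvec n j ∨ v (i + 1) = v i - uvec n j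
  noback : ∀ i : ℤ, i - 1 ∈ dom → i + 1 ∈ dom → v (i + 1) ≠ v (i - 1)

namespace Curve

variable {n : ℕ} (c : Curve n)

/-- The segments of a curve. -/
def segs : Set (Sym2 (Pt n)) :=
  {S | ∃ i : ℤ, i ∈ c.dom ∧ i + 1 ∈ c.dom ∧ S = s(c.v i, c.v (i + 1))}

/-- The connexions between segments of a curve: pairs of consecutive segments. -/
def conn (S T : Sym2 (Pt n)) : Prop :=
  ∃ i : ℤ, i - 1 ∈ c.dom ∧ i + 1 ∈ c.dom ∧
    ((S = s(c.v (i - 1), c.v i) ∧ T = s(c.v i, c.v (i + 1))) ∨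
     (T = s(c.v (i - 1), c.v i) ∧ S = s(c.v i, c.v (i + 1))))

/-- A curve is self-avoiding if each of its segments appears only once. -/
def SelfAvoiding : Prop :=
  ∀ i j : ℤ, i ∈ c.dom → i + 1 ∈ c.dom → j ∈ c.dom → j + 1 ∈ c.dom →
    s(c.v i, c.v (i + 1)) = s(c.v j, c.v (j + 1)) → i = j

/-- A curve without endpoints (indexed by `ℤ`). -/
def NoEndpts : Prop := c.dom = Set.univ

/-- `p` is an endpoint of the curve `c`. -/
def IsEndpt (p : Pt n) : Prop :=
  ∃ i ∈ c.dom, p = c.v i ∧ (i - 1 ∉ c.dom ∨ i + 1 ∉ c.dom)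

/-- `S` is the end segment of `c` at its endpoint `p`. -/
def endSegAt (p : Pt n) (S : Sym2 (Pt n)) : Prop :=
  ∃ i : ℤ, i ∈ c.dom ∧ p = c.v i ∧
    ((i - 1 ∉ c.dom ∧ i + 1 ∈ c.dom ∧ S = s(c.v i, c.v (i + 1))) ∨
     (i + 1 ∉ c.dom ∧ i - 1 ∈ c.dom ∧ S = s(c.v (i - 1), c.v i)))

/-- The number of segments (length) of a curve. -/
def nsegs : ℕ := {i : ℤ | i ∈ c.dom ∧ i + 1 ∈ c.dom}.ncard

end Curve

/-- The trace of a set of curves: its set of segments together with the connexion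
relation between segments.  Two sets of curves are geometrically the same set of
(nonoriented) curves iff they have the same trace. -/
structure Trace (n : ℕ) where
  segs : Set (Sym2 (Pt n))
  conn : Sym2 (Pt n) → Sym2 (Pt n) → Prop

def curveTrace {n : ℕ} (c : Curve n) : Trace n := ⟨c.segs, c.conn⟩

def traceOf {n : ℕ} (E : Set (Curve n)) : Trace n :=
  ⟨{S | ∃ c ∈ E, S ∈ c.segs}, fun S T => ∃ c ∈ E, c.conn S T⟩

/-- Two curves are the same nonoriented curve. -/
def SameCurve {n : ℕ} (c d : Curve n) : Prop := c.segs = d.segs ∧ c.conn = d.conn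

/-- A set of pairwise disjoint self-avoiding curves. -/
def DisjSA {n : ℕ} (E : Set (Curve n)) : Prop :=
  (∀ c ∈ E, c.SelfAvoiding) ∧
  ∀ c ∈ E, ∀ d ∈ E, ¬ SameCurve c d → ∀ S, S ∈ c.segs → S ∉ d.segs

/-- The set of points of `ℝ^n` lying on the segment `S`. -/
def segPts {n : ℕ} (S : Sym2 (Pt n)) : Set (Pt n) :=
  {p | ∃ a b, S = s(a, b) ∧ ∃ t : ℝ, 0 ≤ t ∧ t ≤ 1 ∧ p = a + t • (b - a)}

def Trace.pts {n : ℕ} (T : Trace n) : Set (Pt n) := ⋃ S ∈ T.segs, segPts S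

/-- A set of curves covers `X ⊆ ℝ^n`: each lattice segment containing a point of `X`
appears in one and only one of the curves. -/
def Covers {n : ℕ} (E : Set (Curve n)) (X : Set (Pt n)) : Prop :=
  ∀ S, IsSeg S → (segPts S ∩ X).Nonempty →
    (∃ c ∈ E, S ∈ c.segs) ∧ ∀ c ∈ E, ∀ d ∈ E, S ∈ c.segs → S ∈ d.segs → SameCurve c d

/-- A covering of `ℝ^n` by disjoint self-avoiding curves. -/
def IsCovering {n : ℕ} (E : Set (Curve n)) : Prop := DisjSA E ∧ Covers E Set.univ

/-- A single curve covers `X`. -/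
def CurveCovers {n : ℕ} (c : Curve n) (X : Set (Pt n)) : Prop :=
  ∀ S, IsSeg S → (segPts S ∩ X).Nonempty → S ∈ c.segs

/-- `b` is a curve contained in the curve `a`. -/
def SubCurve {n : ℕ} (b a : Curve n) : Prop :=
  b.segs ⊆ a.segs ∧ ∀ S T, b.conn S T → a.conn S T

/-- The relation `≺` at the level of traces. -/
def TPrec {n : ℕ} (T T' : Trace n) : Prop :=
  T.segs ⊆ T'.segs ∧ ∀ S S', T.conn S S' → T'.conn S S'

/-- `E ≺ F` : each segment of a curve of `E` is a segment of a curve of `F` and each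
connexion between two segments of a curve of `E` also exists in `F`. -/
def Prec {n : ℕ} (E F : Set (Curve n)) : Prop := TPrec (traceOf E) (traceOf F)

/-- Image of a trace under a map of `ℝ^n`. -/
def Trace.map {n : ℕ} (f : Pt n → Pt n) (T : Trace n) : Trace n :=
  ⟨Sym2.map f '' T.segs,
   fun S S' => ∃ A B, T.conn A B ∧ S = Sym2.map f A ∧ S' = Sym2.map f B⟩

/-- Translation of a trace by the vector `t`. -/
def Trace.transl {n : ℕ} (t : Pt n) (T : Trace n) : Trace n := T.map (fun p => p + t)

/-- Property (H) for the pair `(k, l)`. -/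
def SatH {n : ℕ} (A : Set (Curve n)) (k l : ℕ) : Prop :=
  0 < k ∧ 0 < l ∧ k ∣ l ∧ IsCovering A ∧
  (∀ c ∈ A, c.dom.Finite ∧ ∃ x i, latt x ∧ inLat k x ∧ c.IsEndpt x ∧
      c.IsEndpt (x + (k : ℝ) • uvec n i) ∧
      ∀ p, c.IsEndpt p → p = x ∨ p = x + (k : ℝ) • uvec n i) ∧
  (∀ (x : Pt n) (i : Fin n), latt x → inLat k x →
      (∃ c ∈ A, c.IsEndpt x ∧ c.IsEndpt (x + (k : ℝ) • uvec n i)) ∧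
      ∀ c ∈ A, ∀ d ∈ A, c.IsEndpt x → c.IsEndpt (x + (k : ℝ) • uvec n i) →
        d.IsEndpt x → d.IsEndpt (x + (k : ℝ) • uvec n i) → SameCurve c d) ∧
  (∀ t : Pt n, inLat l t → Trace.transl t (traceOf A) = traceOf A)

/-- The trace of the convolution product `A ∗ B`, where `A` satisfies (H) for `(k, l)`:
apply to `B` the homothety of center `0` and ratio `k`, then replace each resulting
segment by the curve of `A` having the same endpoints (connexions come from the curves
of `A`, together with the junctions of the end segments of consecutive `A`-curves). -/
def ConvTrace {n : ℕ} (k : ℕ) (A B : Set (Curve n)) : Trace n where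
  segs := {S | ∃ a b : Pt n, s(a, b) ∈ (traceOf B).segs ∧
    ∃ c ∈ A, c.IsEndpt ((k : ℝ) • a) ∧ c.IsEndpt ((k : ℝ) • b) ∧ S ∈ c.segs}
  conn := fun S S' =>
    (∃ a b : Pt n, s(a, b) ∈ (traceOf B).segs ∧
      ∃ c ∈ A, c.IsEndpt ((k : ℝ) • a) ∧ c.IsEndpt ((k : ℝ) • b) ∧ c.conn S S') ∨
    (∃ a b d : Pt n, (traceOf B).conn s(a, b) s(b, d) ∧
      ∃ c ∈ A, ∃ c' ∈ A, c.IsEndpt ((k : ℝ) • a) ∧ c.IsEndpt ((k : ℝ) • b) ∧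
        c'.IsEndpt ((k : ℝ) • b) ∧ c'.IsEndpt ((k : ℝ) • d) ∧
        ((c.endSegAt ((k : ℝ) • b) S ∧ c'.endSegAt ((k : ℝ) • b) S') ∨
         (c.endSegAt ((k : ℝ) • b) S' ∧ c'.endSegAt ((k : ℝ) • b) S)))

/-- The two-sided identity of the convolution product: the covering consisting of all
curves with one segment. -/
def unitTrace (n : ℕ) : Trace n := ⟨{S | IsSeg S}, fun _ _ => False⟩

/-- `P s` realizes the power `A^s` for the convolution product. -/
def PowersOf {n : ℕ} (A : Set (Curve n)) (k : ℕ) (P : ℕ → Set (Curve n)) : Prop :=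
  (∀ s, DisjSA (P s)) ∧ traceOf (P 0) = unitTrace n ∧
  ∀ s, traceOf (P (s + 1)) = ConvTrace k A (P s)

/-- The trace of `Â`, the inductive limit of the `A^s` for `≺`. -/
def hatTrace {n : ℕ} (P : ℕ → Set (Curve n)) : Trace n :=
  ⟨{S | ∃ s, S ∈ (traceOf (P s)).segs}, fun S T => ∃ s, (traceOf (P s)).conn S T⟩

/-- A pairing relation on `E = {e_1, -e_1, …, e_n, -e_n}`. -/
def IsPairing {n : ℕ} (R : Pt n → Pt n → Prop) : Prop :=
  (∀ u v, R u v → R v u) ∧ (∀ u v, R u v → IsDir u ∧ IsDir v) ∧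
  (∀ u, ¬ R u u) ∧ ∀ u, IsDir u → ∃! v, R u v

/-- The trace of `Â_R` : `Â` with the segments with endpoint `0` connected according
to `R`. -/
def hatRTrace {n : ℕ} (P : ℕ → Set (Curve n)) (R : Pt n → Pt n → Prop) : Trace n :=
  ⟨(hatTrace P).segs,
   fun S T => (hatTrace P).conn S T ∨
     ∃ u v, R u v ∧ S = s((0 : Pt n), u) ∧ T = s((0 : Pt n), v)⟩

/-- The cube `P_{x,h}`. -/
def cube {n : ℕ} (x : Pt n) (h : ℕ) : Set (Pt n) :=
  {p | ∀ i, x i - h ≤ p i ∧ p i ≤ x i + h}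

/-- Restriction of a trace to a region `X` of `ℝ^n`. -/
def Trace.restr {n : ℕ} (T : Trace n) (X : Set (Pt n)) : Trace n :=
  ⟨{S | S ∈ T.segs ∧ segPts S ⊆ X},
   fun S S' => T.conn S S' ∧ segPts S ⊆ X ∧ segPts S' ⊆ X⟩

/-- Condition (C). -/
def CondC {n : ℕ} (T : Trace n) : Prop :=
  ∀ (x : Pt n) (h : ℕ), latt x → 1 ≤ h →
    ∃ y : Pt n, latt y ∧ y ∉ cube x h ∧
      Trace.transl (y - x) (T.restr (cube x h)) = T.restr (cube y h)

/-- `(B(x,r) ∩ T, x) ≅ (B(y,r) ∩ T', y)` : the translation sending `x` to `y` maps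
the part of `T` in the closed ball `B(x,r)` onto the part of `T'` in `B(y,r)`,
preserving the connexions between segments. -/
def BallIso {n : ℕ} (T : Trace n) (x : Pt n) (T' : Trace n) (y : Pt n) (r : ℝ) : Prop :=
  (fun p => p + (y - x)) '' (T.pts ∩ Metric.closedBall x r) =
      T'.pts ∩ Metric.closedBall y r ∧
  (∀ S S', T.conn S S' → segPts S ⊆ Metric.closedBall x r →
      segPts S' ⊆ Metric.closedBall x r →
      T'.conn (Sym2.map (fun p => p + (y - x)) S) (Sym2.map (fun p => p + (y - x)) S')) ∧
  (∀ S S', T'.conn S S' → segPts S ⊆ Metric.closedBall y r →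
      segPts S' ⊆ Metric.closedBall y r →
      T.conn (Sym2.map (fun p => p + (x - y)) S) (Sym2.map (fun p => p + (x - y)) S'))

/-- The local isomorphism property. -/
def LocIsoProp {n : ℕ} (T : Trace n) : Prop :=
  ∀ (x : Pt n) (r : ℝ), 0 ≤ r →
    ∃ t : ℝ, 0 ≤ t ∧ ∀ y : Pt n, ∃ z ∈ Metric.closedBall y t, BallIso T x T z r

/-- Two traces are locally isomorphic. -/
def LocallyIso {n : ℕ} (T T' : Trace n) : Prop :=
  (∀ (x : Pt n) (r : ℝ), 0 ≤ r → ∃ y, BallIso T x T' y r) ∧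
  (∀ (y : Pt n) (r : ℝ), 0 ≤ r → ∃ x, BallIso T' y T x r)

/-- `Ω_{s,x}` : suppress the connexions between segments whose common endpoint lies in
`x + k^s ℤ^n`. -/
def OmegaTrace {n : ℕ} (k s : ℕ) (x : Pt n) (T : Trace n) : Trace n :=
  ⟨T.segs, fun S S' => T.conn S S' ∧ ¬ ∃ p, p ∈ S ∧ p ∈ S' ∧ inLat (k ^ s) (p - x)⟩

/-- `Σ_{s,x}(E)` : for each curve `D` of `E` passing through `x`, the curve(s) with
endpoint `x` contained in `D` having maximal length, this length being limited to
`8^s`. -/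
def SigmaSet {n : ℕ} (s : ℕ) (x : Pt n) (E : Set (Curve n)) : Set (Curve n) :=
  {b | ∃ D ∈ E, SubCurve b D ∧ b.IsEndpt x ∧ b.nsegs ≤ 8 ^ s ∧
    ∀ b' : Curve n, SubCurve b' D → b'.IsEndpt x → b'.nsegs ≤ 8 ^ s →
      SubCurve b b' → SameCurve b b'}

/-- A positive (orientation preserving) isometry of `ℝ^n`. -/
def PosIsom {n : ℕ} (f : Pt n → Pt n) : Prop :=
  ∃ (g : Pt n ≃ₗᵢ[ℝ] Pt n) (t : Pt n), (∀ x, f x = g x + t) ∧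
    0 < LinearMap.det (g.toLinearEquiv.toLinearMap)

/-- `E` consists of exactly `m` curves. -/
def HasExactly {n : ℕ} (E : Set (Curve n)) (m : ℕ) : Prop :=
  ∃ L : List (Curve n), L.length = m ∧ (∀ c ∈ L, c ∈ E) ∧
    L.Pairwise (fun c d => ¬ SameCurve c d) ∧ ∀ c ∈ E, ∃ d ∈ L, SameCurve c d

/-- `E` consists of at most `m` curves. -/
def AtMost {n : ℕ} (E : Set (Curve n)) (m : ℕ) : Prop :=
  ∃ L : List (Curve n), L.length ≤ m ∧ ∀ c ∈ E, ∃ d ∈ L, SameCurve c d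

/-- The set of points of a curve. -/
def curvePts {n : ℕ} (c : Curve n) : Set (Pt n) := ⋃ S ∈ c.segs, segPts S


lemma uvec_ne_zero {n : ℕ} (j : Fin n) : uvec n j ≠ 0 := by
  simp [uvec]

namespace Curve

variable {n : ℕ} {c : Curve n} {S T : Sym2 (Pt n)} {p : Pt n}

lemma sub_one_mem_or_add_one_mem {i : ℤ} (hi : i ∈ c.dom) : i - 1 ∈ c.dom ∨ i + 1 ∈ c.dom := by
  obtain ⟨m, hm, hm'⟩ := c.nontriv
  rcases lt_or_ge m i with h | h
  · exact Or.inl (c.ordConn.out hm hi ⟨by omega, by omega⟩)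
  · exact Or.inr (c.ordConn.out hi hm' ⟨by omega, by omega⟩)

lemma v_add_one_ne {i : ℤ} (hi : i ∈ c.dom) (hi' : i + 1 ∈ c.dom) : c.v (i + 1) ≠ c.v i := by
  obtain ⟨j, h | h⟩ := c.step i hi hi' <;> rw [h] <;> simp [uvec_ne_zero]

lemma conn_symm (h : c.conn S T) : c.conn T S := by
  obtain ⟨i, h1, h2, h⟩ := h
  exact ⟨i, h1, h2, h.symm⟩

lemma conn_mem_left (h : c.conn S T) : S ∈ c.segs := by
  obtain ⟨i, h1, h2, h⟩ := h
  have hi : i ∈ c.dom := c.ordConn.out h1 h2 ⟨by omega, by omega⟩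
  rcases h with ⟨rfl, -⟩ | ⟨-, rfl⟩
  · exact ⟨i - 1, h1, by simpa using hi, by simp⟩
  · exact ⟨i, hi, h2, rfl⟩

lemma conn_mem_right (h : c.conn S T) : T ∈ c.segs := conn_mem_left (conn_symm h)

lemma exists_common_of_conn (h : c.conn S T) : ∃ a b e, S = s(a, b) ∧ T = s(b, e) := by
  obtain ⟨i, -, -, ⟨rfl, rfl⟩ | ⟨rfl, rfl⟩⟩ := h
  · exact ⟨_, _, _, rfl, rfl⟩
  · exact ⟨_, _, _, Sym2.eq_swap, Sym2.eq_swap⟩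

lemma conn_irrefl (hc : c.SelfAvoiding) : ¬ c.conn S S := by
  rintro ⟨i, h1, h2, h⟩
  have hi : i ∈ c.dom := c.ordConn.out h1 h2 ⟨by omega, by omega⟩
  have key : s(c.v (i - 1), c.v (i - 1 + 1)) = s(c.v i, c.v (i + 1)) := by
    rw [sub_add_cancel]
    rcases h with ⟨h, h'⟩ | ⟨h, h'⟩ <;> rw [← h, ← h']
  have := hc _ _ h1 (by simpa using hi) hi h2 key
  omega

lemma ne_of_mem_segs {a b : Pt n} (h : s(a, b) ∈ c.segs) : a ≠ b := by
  obtain ⟨i, hi, hi', h⟩ := h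
  have := v_add_one_ne hi hi'
  rintro rfl
  rw [Sym2.eq_iff] at h
  rcases h with ⟨h, h'⟩ | ⟨h, h'⟩ <;> exact this (by rw [← h, ← h'])

lemma segs_nonempty (c : Curve n) : c.segs.Nonempty := by
  obtain ⟨i, hi, hi'⟩ := c.nontriv
  exact ⟨_, i, hi, hi', rfl⟩

/-- The segments of a curve are connected by its connexions. -/
lemma of_mem_segs {Q : Sym2 (Pt n) → Prop} (hQ : ∀ S T, c.conn S T → Q S → Q T)
    (hS : S ∈ c.segs) (hT : T ∈ c.segs) (h : Q S) : Q T := by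
  have up : ∀ m : ℕ, ∀ i : ℤ, i ∈ c.dom → i + m + 1 ∈ c.dom →
      (Q s(c.v i, c.v (i + 1)) ↔ Q s(c.v (i + m), c.v (i + m + 1))) := by
    intro m
    induction m with
    | zero => intro i _ _; simp
    | succ m ih =>
      intro i hi hm
      push_cast at hm ⊢
      have h1 : i + m + 1 ∈ c.dom := c.ordConn.out hi hm ⟨by omega, by omega⟩
      have h2 : i + m ∈ c.dom := c.ordConn.out hi hm ⟨by omega, by omega⟩
      have hconn : c.conn s(c.v (i + m), c.v (i + m + 1))
          s(c.v (i + (m + 1)), c.v (i + (m + 1) + 1)) :=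
        ⟨i + m + 1, by simpa using h2, by simpa [add_assoc] using hm,
          Or.inl ⟨by simp, by simp [add_assoc]⟩⟩
      exact (ih i hi h1).trans ⟨hQ _ _ hconn, hQ _ _ (conn_symm hconn)⟩
  obtain ⟨i, hi, hi', rfl⟩ := hS
  obtain ⟨j, hj, hj', rfl⟩ := hT
  rcases le_total i j with hij | hij
  · obtain ⟨m, rfl⟩ := Int.le.dest hij
    exact (up m i hi hj').1 h
  · obtain ⟨m, rfl⟩ := Int.le.dest hij
    exact (up m j hj hi').2 h

lemma isEndpt_iff : c.IsEndpt p ↔ ∃ S, c.endSegAt p S := by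
  constructor
  · rintro ⟨i, hi, hp, h⟩
    rcases h with h | h
    · exact ⟨_, i, hi, hp, Or.inl ⟨h, (sub_one_mem_or_add_one_mem hi).resolve_left h, rfl⟩⟩
    · exact ⟨_, i, hi, hp, Or.inr ⟨h, (sub_one_mem_or_add_one_mem hi).resolve_right h, rfl⟩⟩
  · rintro ⟨S, i, hi, hp, ⟨h, -, -⟩ | ⟨h, -, -⟩⟩
    · exact ⟨i, hi, hp, Or.inl h⟩
    · exact ⟨i, hi, hp, Or.inr h⟩

/-- The end segments of a self-avoiding curve are determined by its segments and connexions. -/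
lemma endSegAt_iff (hc : c.SelfAvoiding) :
    c.endSegAt p S ↔ S ∈ c.segs ∧ p ∈ S ∧ ∀ T, c.conn S T → p ∉ T := by
  constructor
  · rintro ⟨i, hi, rfl, ⟨h1, h2, rfl⟩ | ⟨h1, h2, rfl⟩⟩
    · refine ⟨⟨i, hi, h2, rfl⟩, by simp, ?_⟩
      rintro T ⟨m, hm, hm', h⟩ hT
      have hmd : m ∈ c.dom := c.ordConn.out hm hm' ⟨by omega, by omega⟩
      rcases h with ⟨h, rfl⟩ | ⟨rfl, h⟩
      · have := hc i (m - 1) hi h2 hm (by simpa using hmd) (by simpa using h)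
        subst this
        have e1 := v_add_one_ne hm (by simpa using hmd)
        have e2 := c.noback m hm hm'
        simp only [sub_add_cancel] at e1
        rcases Sym2.mem_iff.1 hT with h | h
        · exact e1 h.symm
        · exact e2 h.symm
      · exact h1 (hc i m hi h2 hmd hm' h ▸ hm)
    · have hi' : i - 1 + 1 ∈ c.dom := by simpa using hi
      refine ⟨⟨i - 1, h2, hi', by simp⟩, by simp, ?_⟩
      rintro T ⟨m, hm, hm', h⟩ hT
      have hmd : m ∈ c.dom := c.ordConn.out hm hm' ⟨by omega, by omega⟩
      rcases h with ⟨h, rfl⟩ | ⟨rfl, h⟩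
      · have := hc (i - 1) (m - 1) h2 hi' hm (by simpa using hmd) (by simpa using h)
        exact h1 (by rwa [show i = m by omega])
      · have := hc (i - 1) m h2 hi' hmd hm' (by simpa using h)
        obtain rfl : i = m + 1 := by omega
        have e1 := v_add_one_ne hmd hm'
        have e2 := c.noback m hm hm'
        rcases Sym2.mem_iff.1 hT with h | h
        · exact e2 h
        · exact e1 h
  · rintro ⟨⟨i, hi, hi', rfl⟩, hp, h⟩
    rcases Sym2.mem_iff.1 hp with rfl | rfl
    · refine ⟨i, hi, rfl, Or.inl ⟨fun h1 => ?_, hi', rfl⟩⟩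
      exact h _ ⟨i, h1, hi', Or.inr ⟨rfl, rfl⟩⟩ (by simp)
    · refine ⟨i + 1, hi', rfl, Or.inr ⟨fun h1 => ?_, by simpa using hi, by simp⟩⟩
      exact h _ ⟨i + 1, by simpa using hi, h1, Or.inl ⟨by simp, rfl⟩⟩ (by simp)

lemma mem_segs_of_endSegAt (h : c.endSegAt p S) : S ∈ c.segs := by
  obtain ⟨i, hi, -, ⟨-, h2, rfl⟩ | ⟨-, h2, rfl⟩⟩ := h
  · exact ⟨i, hi, h2, rfl⟩
  · exact ⟨i - 1, h2, by simpa using hi, by simp⟩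

lemma mem_of_endSegAt (h : c.endSegAt p S) : p ∈ S := by
  obtain ⟨i, hi, rfl, ⟨-, h2, rfl⟩ | ⟨-, h2, rfl⟩⟩ := h <;> simp

lemma dom_finite_of_isEndpt {q : Pt n} (hp : c.IsEndpt p) (hq : c.IsEndpt q) (hpq : p ≠ q) :
    c.dom.Finite := by
  obtain ⟨i, hi, rfl, h⟩ := hp
  obtain ⟨j, hj, rfl, h'⟩ := hq
  have hij : i ≠ j := by rintro rfl; exact hpq rfl
  have lower : ∀ {m x : ℤ}, m ∈ c.dom → m - 1 ∉ c.dom → x ∈ c.dom → m ≤ x := by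
    intro m x hm hm' hx
    by_contra! hlt
    exact hm' (c.ordConn.out hx hm ⟨by omega, by omega⟩)
  have upper : ∀ {m x : ℤ}, m ∈ c.dom → m + 1 ∉ c.dom → x ∈ c.dom → x ≤ m := by
    intro m x hm hm' hx
    by_contra! hlt
    exact hm' (c.ordConn.out hm hx ⟨by omega, by omega⟩)
  rcases h with h | h <;> rcases h' with h' | h'
  · exact absurd (le_antisymm (lower hi h hj) (lower hj h' hi)) hij
  · exact (Set.finite_Icc i j).subset fun x hx => ⟨lower hi h hx, upper hj h' hx⟩
  · exact (Set.finite_Icc j i).subset fun x hx => ⟨lower hj h' hx, upper hi h hx⟩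
  · exact absurd (le_antisymm (upper hj h' hi) (upper hi h hj)) hij

lemma exists_uvec_of_mem_segs {a b : Pt n} (h : s(a, b) ∈ c.segs) :
    latt a ∧ latt b ∧ ∃ j, b = a + uvec n j ∨ a = b + uvec n j := by
  obtain ⟨i, hi, hi', h⟩ := h
  have h1 := c.lattice i hi
  have h2 := c.lattice _ hi'
  obtain ⟨j, hj⟩ := c.step i hi hi'
  rcases Sym2.eq_iff.1 h with ⟨rfl, rfl⟩ | ⟨rfl, rfl⟩
  · refine ⟨h1, h2, j, hj.imp id fun h => ?_⟩
    rw [h]; simp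
  · refine ⟨h2, h1, j, hj.symm.imp (fun h => ?_) id⟩
    rw [h]; simp

end Curve

namespace SameCurve

variable {n : ℕ} {c d : Curve n} {p : Pt n}

lemma endSegAt {S : Sym2 (Pt n)} (h : SameCurve c d) (hc : c.SelfAvoiding) (hd : d.SelfAvoiding)
    (hS : c.endSegAt p S) : d.endSegAt p S := by
  rw [Curve.endSegAt_iff hd, ← h.1, ← h.2, ← Curve.endSegAt_iff hc]
  exact hS

lemma isEndpt (h : SameCurve c d) (hc : c.SelfAvoiding) (hd : d.SelfAvoiding)
    (hp : c.IsEndpt p) : d.IsEndpt p := by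
  rw [Curve.isEndpt_iff] at hp ⊢
  exact hp.imp fun S hS => h.endSegAt hc hd hS

end SameCurve

namespace DisjSA

variable {n : ℕ} {E : Set (Curve n)} {c d : Curve n} {S T : Sym2 (Pt n)}

lemma sameCurve (hE : DisjSA E) (hc : c ∈ E) (hd : d ∈ E) (h : S ∈ c.segs) (h' : S ∈ d.segs) :
    SameCurve c d :=
  by_contra fun hn => hE.2 c hc d hd hn S h h'

lemma conn_of_traceOf (hE : DisjSA E) (hc : c ∈ E) (hS : S ∈ c.segs)
    (h : (traceOf E).conn S T) : c.conn S T := by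
  obtain ⟨d, hd, h⟩ := h
  rw [(hE.sameCurve hc hd hS (Curve.conn_mem_left h)).2]
  exact h

end DisjSA

lemma inLat.latt {n m : ℕ} {p : Pt n} (h : inLat m p) : latt p := fun i => by
  obtain ⟨c, hc⟩ := h i
  exact ⟨m * c, by simp [hc]⟩

lemma inLat.smul {n m : ℕ} {p : Pt n} (i : ℕ) (h : inLat m p) :
    inLat (i * m) ((i : ℝ) • p) := fun r => by
  obtain ⟨c, hc⟩ := h r
  exact ⟨c, by simp [hc, mul_assoc]⟩

lemma inLat.exists_eq_smul {n i m : ℕ} {p : Pt n} (h : inLat (i * m) p) :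
    ∃ q : Pt n, inLat m q ∧ p = (i : ℝ) • q := by
  choose f hf using h
  refine ⟨WithLp.toLp 2 fun r => (m : ℝ) * f r, fun r => ⟨f r, rfl⟩, ?_⟩
  ext r
  simp [hf, mul_assoc]

lemma inLat.of_dvd {n m m' : ℕ} {p : Pt n} (h : inLat m' p) (hm : m ∣ m') : inLat m p :=
  fun r => by
    obtain ⟨c, hc⟩ := h r
    obtain ⟨q, rfl⟩ := hm
    exact ⟨q * c, by simp [hc, mul_assoc]⟩

lemma inLat.neg {n m : ℕ} {p : Pt n} (h : inLat m p) : inLat m (-p) := fun r => by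
  obtain ⟨c, hc⟩ := h r
  exact ⟨-c, by simp [hc]⟩

/-- Translation of a segment. -/
def tr {n : ℕ} (t : Pt n) : Sym2 (Pt n) → Sym2 (Pt n) := Sym2.map (fun p => p + t)

section Translation

variable {n : ℕ} (t : Pt n)

@[simp] lemma tr_mk (a b : Pt n) : tr t s(a, b) = s(a + t, b + t) := rfl

@[simp] lemma tr_neg_tr (S : Sym2 (Pt n)) : tr (-t) (tr t S) = S := by
  induction S with | _ a b => simp

@[simp] lemma tr_tr_neg (S : Sym2 (Pt n)) : tr t (tr (-t) S) = S := by
  induction S with | _ a b => simp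

lemma add_mem_tr {p : Pt n} {S : Sym2 (Pt n)} : p ∈ S → p + t ∈ tr t S := by
  induction S with | _ a b => simp

variable {t} {T : Trace n}

lemma transl_eq_of_forall (hs : ∀ S ∈ T.segs, tr t S ∈ T.segs ∧ tr (-t) S ∈ T.segs)
    (hc : ∀ S S', T.conn S S' → T.conn (tr t S) (tr t S') ∧ T.conn (tr (-t) S) (tr (-t) S')) :
    T.transl t = T := by
  have e1 : (T.transl t).segs = T.segs := by
    ext S
    constructor
    · rintro ⟨S, hS, rfl⟩
      exact (hs S hS).1
    · intro hS
      exact ⟨_, (hs S hS).2, tr_tr_neg t S⟩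
  have e2 : (T.transl t).conn = T.conn := by
    ext S S'
    constructor
    · rintro ⟨S, S', h, rfl, rfl⟩
      exact (hc S S' h).1
    · intro h
      exact ⟨_, _, (hc S S' h).2, (tr_tr_neg t S).symm, (tr_tr_neg t S').symm⟩
  calc T.transl t = ⟨(T.transl t).segs, (T.transl t).conn⟩ := rfl
    _ = T := by rw [e1, e2]

lemma tr_mem_segs_of_transl_eq (h : T.transl t = T) {S : Sym2 (Pt n)} (hS : S ∈ T.segs) :
    tr t S ∈ T.segs := by
  rw [← h]
  exact ⟨S, hS, rfl⟩

lemma conn_tr_of_transl_eq (h : T.transl t = T) {S S' : Sym2 (Pt n)} (hS : T.conn S S') :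
    T.conn (tr t S) (tr t S') := by
  rw [← h]
  exact ⟨S, S', hS, rfl, rfl⟩

end Translation

namespace SatH

variable {n k l : ℕ} {A : Set (Curve n)} {c d D : Curve n} {a b p q r : Pt n}

lemma disjSA (hA : SatH A k l) : DisjSA A := hA.2.2.2.1.1

lemma selfAvoiding (hA : SatH A k l) (hc : c ∈ A) : c.SelfAvoiding := hA.disjSA.1 c hc

lemma smul_inj (hA : SatH A k l) : (k : ℝ) • a = (k : ℝ) • b ↔ a = b := by
  have : (k : ℝ) ≠ 0 := by exact_mod_cast hA.1.ne'
  exact smul_right_inj this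

lemma exists_mem_segs (hA : SatH A k l) {S : Sym2 (Pt n)} (hS : IsSeg S) :
    ∃ c ∈ A, S ∈ c.segs := by
  refine (hA.2.2.2.1.2 S hS ?_).1
  obtain ⟨x, i, -, rfl⟩ := hS
  exact ⟨x, ⟨x, _, rfl, 0, le_rfl, zero_le_one, by simp⟩, trivial⟩

lemma eq_or_eq_of_isEndpt (hA : SatH A k l) (hc : c ∈ A) (hp : c.IsEndpt p) (hq : c.IsEndpt q)
    (hpq : p ≠ q) (hr : c.IsEndpt r) : r = p ∨ r = q := by
  obtain ⟨-, x, i, -, -, -, -, h⟩ := hA.2.2.2.2.1 c hc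
  rcases h p hp with rfl | rfl <;> rcases h q hq with rfl | rfl <;>
    rcases h r hr with rfl | rfl <;> simp_all

lemma inLat_smul (h : latt a) : inLat k ((k : ℝ) • a) := fun i => by
  obtain ⟨m, hm⟩ := h i
  exact ⟨m, by simp [hm]⟩

lemma exists_joining (hA : SatH A k l) (h : s(a, b) ∈ D.segs) :
    ∃ c ∈ A, c.IsEndpt ((k : ℝ) • a) ∧ c.IsEndpt ((k : ℝ) • b) := by
  obtain ⟨ha, hb, m, rfl | rfl⟩ := Curve.exists_uvec_of_mem_segs h
  · have := (hA.2.2.2.2.2.1 _ m (inLat_smul ha).latt (inLat_smul ha)).1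
    simpa only [smul_add] using this
  · obtain ⟨c, hc, h1, h2⟩ := (hA.2.2.2.2.2.1 _ m (inLat_smul hb).latt (inLat_smul hb)).1
    exact ⟨c, hc, by simpa only [smul_add] using h2, h1⟩

lemma sameCurve_of_joining (hA : SatH A k l) (h : s(a, b) ∈ D.segs) (hc : c ∈ A) (hd : d ∈ A)
    (hca : c.IsEndpt ((k : ℝ) • a)) (hcb : c.IsEndpt ((k : ℝ) • b))
    (hda : d.IsEndpt ((k : ℝ) • a)) (hdb : d.IsEndpt ((k : ℝ) • b)) : SameCurve c d := by
  obtain ⟨ha, hb, m, rfl | rfl⟩ := Curve.exists_uvec_of_mem_segs h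
  · rw [smul_add] at hcb hdb
    exact (hA.2.2.2.2.2.1 _ m (inLat_smul ha).latt (inLat_smul ha)).2 c hc d hd hca hcb hda hdb
  · rw [smul_add] at hca hda
    exact (hA.2.2.2.2.2.1 _ m (inLat_smul hb).latt (inLat_smul hb)).2 c hc d hd hcb hca hdb hda

/-- Curves of `A` sharing a segment join the same pair of points. -/
lemma pair_eq (hA : SatH A k l) {a' b' : Pt n} {S : Sym2 (Pt n)} (hc : c ∈ A) (hd : d ∈ A)
    (hcS : S ∈ c.segs) (hdS : S ∈ d.segs) (hab : a ≠ b) (hab' : a' ≠ b')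
    (hca : c.IsEndpt ((k : ℝ) • a)) (hcb : c.IsEndpt ((k : ℝ) • b))
    (hda : d.IsEndpt ((k : ℝ) • a')) (hdb : d.IsEndpt ((k : ℝ) • b')) : s(a, b) = s(a', b') := by
  have hs := hA.disjSA.sameCurve hc hd hcS hdS
  have h0 : (k : ℝ) • a' ≠ (k : ℝ) • b' := fun h => hab' (hA.smul_inj.1 h)
  have h1 := hA.eq_or_eq_of_isEndpt hd hda hdb h0
    (hs.isEndpt (hA.selfAvoiding hc) (hA.selfAvoiding hd) hca)
  have h2 := hA.eq_or_eq_of_isEndpt hd hda hdb h0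
    (hs.isEndpt (hA.selfAvoiding hc) (hA.selfAvoiding hd) hcb)
  rw [hA.smul_inj, hA.smul_inj] at h1 h2
  rw [Sym2.eq_iff]
  rcases h1 with rfl | rfl <;> rcases h2 with rfl | rfl <;> simp_all

/-- Translates of curves of `A` by vectors of `l·ℤ^n` are curves of `A`. -/
lemma exists_translate (hA : SatH A k l) {t : Pt n} (ht : inLat l t) (hc : c ∈ A) :
    ∃ d ∈ A, (∀ S ∈ c.segs, tr t S ∈ d.segs) ∧ (∀ S T, c.conn S T → d.conn (tr t S) (tr t T)) ∧
      (∀ p S, c.endSegAt p S → d.endSegAt (p + t) (tr t S)) ∧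
      ∀ p, c.IsEndpt p → d.IsEndpt (p + t) := by
  have hinv := hA.2.2.2.2.2.2
  obtain ⟨S₀, hS₀⟩ := c.segs_nonempty
  obtain ⟨d, hd, hdS⟩ := tr_mem_segs_of_transl_eq (hinv t ht) (S := S₀) ⟨c, hc, hS₀⟩
  have hconn : ∀ S T, c.conn S T → tr t S ∈ d.segs → d.conn (tr t S) (tr t T) :=
    fun S T h hS => hA.disjSA.conn_of_traceOf hd hS (conn_tr_of_transl_eq (hinv t ht) ⟨c, hc, h⟩)
  have hsegs : ∀ S ∈ c.segs, tr t S ∈ d.segs := fun S hS =>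
    Curve.of_mem_segs (Q := fun S => tr t S ∈ d.segs)
      (fun S T h hS => Curve.conn_mem_right (hconn S T h hS)) hS₀ hS hdS
  have hend : ∀ p S, c.endSegAt p S → d.endSegAt (p + t) (tr t S) := by
    intro p S h
    rw [Curve.endSegAt_iff (hA.selfAvoiding hc)] at h
    rw [Curve.endSegAt_iff (hA.selfAvoiding hd)]
    refine ⟨hsegs S h.1, add_mem_tr t h.2.1, fun T hT hp => ?_⟩
    have h1 := conn_tr_of_transl_eq (hinv (-t) ht.neg) ⟨d, hd, hT⟩
    rw [tr_neg_tr] at h1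
    refine h.2.2 _ (hA.disjSA.conn_of_traceOf hc h.1 h1) ?_
    simpa using add_mem_tr (-t) hp
  refine ⟨d, hd, hsegs, fun S T h => hconn S T h (hsegs S (Curve.conn_mem_left h)), hend, ?_⟩
  intro p hp
  rw [Curve.isEndpt_iff] at hp ⊢
  obtain ⟨S, hS⟩ := hp
  exact ⟨_, hend p S hS⟩

end SatH

/-- The segments of the curve obtained from `i·D` by replacing each segment by the curve of `A`
having the same endpoints. -/
def convSegs {n : ℕ} (i : ℕ) (A : Set (Curve n)) (D : Curve n) : Set (Sym2 (Pt n)) :=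
  {S | ∃ a b : Pt n, s(a, b) ∈ D.segs ∧
    ∃ c ∈ A, c.IsEndpt ((i : ℝ) • a) ∧ c.IsEndpt ((i : ℝ) • b) ∧ S ∈ c.segs}

section Conv

variable {n i j k l : ℕ} {A B : Set (Curve n)} {D : Curve n} {S S' : Sym2 (Pt n)}

lemma mem_convTrace_segs : S ∈ (ConvTrace i A B).segs ↔ ∃ D ∈ B, S ∈ convSegs i A D := by
  constructor
  · rintro ⟨a, b, ⟨D, hD, h⟩, h'⟩
    exact ⟨D, hD, a, b, h, h'⟩
  · rintro ⟨D, hD, a, b, h, h'⟩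
    exact ⟨a, b, ⟨D, hD, h⟩, h'⟩

/-- The connexions of `A ∗ B`, with the symmetry of the junctions taken into account. -/
lemma convTrace_conn_cases (h : (ConvTrace i A B).conn S S') :
    (∃ c ∈ A, c.conn S S') ∨
    ∃ a b d : Pt n, ∃ D ∈ B, D.conn s(a, b) s(b, d) ∧ ∃ c ∈ A, ∃ c' ∈ A,
      c.IsEndpt ((i : ℝ) • a) ∧ c.IsEndpt ((i : ℝ) • b) ∧
      c'.IsEndpt ((i : ℝ) • b) ∧ c'.IsEndpt ((i : ℝ) • d) ∧
      c.endSegAt ((i : ℝ) • b) S ∧ c'.endSegAt ((i : ℝ) • b) S' := by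
  rcases h with ⟨-, -, -, c, hc, -, -, h⟩ |
    ⟨a, b, d, ⟨D, hD, h⟩, c, hc, c', hc', h1, h2, h3, h4, h5⟩
  · exact Or.inl ⟨c, hc, h⟩
  · right
    rcases h5 with ⟨h5, h6⟩ | ⟨h6, h5⟩
    · exact ⟨a, b, d, D, hD, h, c, hc, c', hc', h1, h2, h3, h4, h5, h6⟩
    · refine ⟨d, b, a, D, hD, ?_, c', hc', c, hc, h4, h3, h2, h1, h5, h6⟩
      rw [Sym2.eq_swap (a := d), Sym2.eq_swap (a := b) (b := a)]
      exact Curve.conn_symm h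

lemma convTrace_conn_junction {a b d : Pt n} {c c' : Curve n} (hD : D ∈ B)
    (h : D.conn s(a, b) s(b, d)) (hc : c ∈ A) (hc' : c' ∈ A)
    (hca : c.IsEndpt ((i : ℝ) • a)) (hc'd : c'.IsEndpt ((i : ℝ) • d))
    (hS : c.endSegAt ((i : ℝ) • b) S) (hS' : c'.endSegAt ((i : ℝ) • b) S') :
    (ConvTrace i A B).conn S S' :=
  Or.inr ⟨a, b, d, ⟨D, hD, h⟩, c, hc, c', hc', hca, Curve.isEndpt_iff.2 ⟨S, hS⟩,
    Curve.isEndpt_iff.2 ⟨S', hS'⟩, hc'd, Or.inl ⟨hS, hS'⟩⟩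

lemma convSegs_nonempty (hA : SatH A i j) (D : Curve n) : (convSegs i A D).Nonempty := by
  obtain ⟨U, hU⟩ := D.segs_nonempty
  induction U with | _ a b =>
  obtain ⟨c, hc, h1, h2⟩ := hA.exists_joining hU
  obtain ⟨S, hS⟩ := c.segs_nonempty
  exact ⟨S, a, b, hU, c, hc, h1, h2, hS⟩

lemma convSegs_of_conn (hA : SatH A i j) (hB : SatH B k l) (hD : D ∈ B)
    (hS : S ∈ convSegs i A D) (h : (ConvTrace i A B).conn S S') : S' ∈ convSegs i A D := by
  obtain ⟨a, b, hab, c, hc, hca, hcb, hSc⟩ := hS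
  rcases convTrace_conn_cases h with
    ⟨c₁, hc₁, h⟩ | ⟨a₁, b₁, d₁, D₁, hD₁, h, c₁, hc₁, c₂, hc₂, h1, h2, h3, h4, h5, h6⟩
  · exact ⟨a, b, hab, c, hc, hca, hcb, Curve.conn_mem_right
      (hA.disjSA.conn_of_traceOf hc hSc ⟨c₁, hc₁, h⟩)⟩
  · have hD₁S := Curve.conn_mem_left h
    have e := hA.pair_eq hc hc₁ hSc (Curve.mem_segs_of_endSegAt h5) (Curve.ne_of_mem_segs hab)
      (Curve.ne_of_mem_segs hD₁S) hca hcb h1 h2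
    rw [← e] at h
    exact ⟨b₁, d₁, Curve.conn_mem_right (hB.disjSA.conn_of_traceOf hD hab ⟨D₁, hD₁, h⟩),
      c₂, hc₂, h3, h4, Curve.mem_segs_of_endSegAt h6⟩

lemma of_mem_convSegs (hA : SatH A i j) (hD : D ∈ B) {Q : Sym2 (Pt n) → Prop}
    (hQ : ∀ S T, (ConvTrace i A B).conn S T → Q S → Q T)
    (hS : S ∈ convSegs i A D) (hS' : S' ∈ convSegs i A D) (h : Q S) : Q S' := by
  have hQc : ∀ a b, s(a, b) ∈ D.segs → ∀ c ∈ A, c.IsEndpt ((i : ℝ) • a) →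
      c.IsEndpt ((i : ℝ) • b) → ∀ S S', S ∈ c.segs → S' ∈ c.segs → Q S → Q S' := by
    intro a b hab c hc hca hcb S S' hS hS'
    exact Curve.of_mem_segs (fun S T hST =>
      hQ S T (Or.inl ⟨a, b, ⟨D, hD, hab⟩, c, hc, hca, hcb, hST⟩))
      hS hS'
  obtain ⟨a, b, hab, c, hc, hca, hcb, hSc⟩ := hS
  obtain ⟨a', b', hab', c', hc', hca', hcb', hSc'⟩ := hS'
  let R : Sym2 (Pt n) → Prop := fun U => ∀ a b, U = s(a, b) → ∀ c ∈ A, c.IsEndpt ((i : ℝ) • a) →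
    c.IsEndpt ((i : ℝ) • b) → ∀ S ∈ c.segs, Q S
  have hR : ∀ U V, D.conn U V → R U → R V := by
    intro U V hUV hU x y hxy c₂ hc₂ hx hy S₂ hS₂
    subst hxy
    obtain ⟨a, b, d, rfl, e⟩ := Curve.exists_common_of_conn hUV
    obtain ⟨c₁, hc₁, h1, h2⟩ := hA.exists_joining (Curve.conn_mem_left hUV)
    have hbd : c₂.IsEndpt ((i : ℝ) • b) ∧ c₂.IsEndpt ((i : ℝ) • d) := by
      rcases Sym2.eq_iff.1 e with ⟨rfl, rfl⟩ | ⟨rfl, rfl⟩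
      exacts [⟨hx, hy⟩, ⟨hy, hx⟩]
    rw [e] at hUV
    obtain ⟨T₁, hT₁⟩ := Curve.isEndpt_iff.1 h2
    obtain ⟨T₂, hT₂⟩ := Curve.isEndpt_iff.1 hbd.1
    refine hQc b d (Curve.conn_mem_right hUV) c₂ hc₂ hbd.1 hbd.2 T₂ S₂
      (Curve.mem_segs_of_endSegAt hT₂) hS₂ ?_
    refine hQ T₁ T₂ (convTrace_conn_junction hD hUV hc₁ hc₂ h1 hbd.2 hT₁ hT₂) ?_
    exact hU a b rfl c₁ hc₁ h1 h2 T₁ (Curve.mem_segs_of_endSegAt hT₁)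
  have hRab : R s(a, b) := by
    intro x y hxy c₂ hc₂ hx hy S₂ hS₂
    rw [hxy] at hab
    have hs : SameCurve c c₂ := by
      rcases Sym2.eq_iff.1 hxy with ⟨rfl, rfl⟩ | ⟨rfl, rfl⟩
      · exact hA.sameCurve_of_joining hab hc hc₂ hca hcb hx hy
      · exact hA.sameCurve_of_joining hab hc hc₂ hcb hca hx hy
    exact hQc x y hab c₂ hc₂ hx hy S S₂ (hs.1 ▸ hSc) hS₂ h
  exact Curve.of_mem_segs hR hab hab' hRab a' b' rfl c' hc' hca' hcb' S' hSc'

variable {P : Set (Curve n)} {c : Curve n}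

/-- A curve of `A ∗ B` meeting the substitute of `D` coincides with it. -/
lemma segs_eq_convSegs (hA : SatH A i j) (hB : SatH B k l) (hP : DisjSA P)
    (hPt : traceOf P = ConvTrace i A B) (hc : c ∈ P) (hD : D ∈ B)
    (hS : S ∈ c.segs) (hS' : S ∈ convSegs i A D) : c.segs = convSegs i A D := by
  apply Set.Subset.antisymm
  · intro T hT
    refine Curve.of_mem_segs (Q := (· ∈ convSegs i A D)) (fun U V hUV hU => ?_) hS hT hS'
    exact convSegs_of_conn hA hB hD hU (hPt ▸ ⟨c, hc, hUV⟩)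
  · intro T hT
    refine of_mem_convSegs hA hD (Q := (· ∈ c.segs)) (fun U V hUV hU => ?_) hS' hT hS
    rw [← hPt] at hUV
    exact Curve.conn_mem_right (hP.conn_of_traceOf hc hU hUV)

lemma isEndpt_of_segs_eq (hA : SatH A i j) (hB : SatH B k l) (hP : DisjSA P)
    (hPt : traceOf P = ConvTrace i A B) (hc : c ∈ P) (hD : D ∈ B)
    (h : c.segs = convSegs i A D) {p : Pt n} :
    c.IsEndpt p ↔ ∃ q, p = (i : ℝ) • q ∧ D.IsEndpt q := by
  rw [Curve.isEndpt_iff]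
  simp only [Curve.isEndpt_iff, Curve.endSegAt_iff (hP.1 c hc),
    Curve.endSegAt_iff (hB.selfAvoiding hD)]
  constructor
  · rintro ⟨S, hS, hp, hend⟩
    have hend' : ∀ T, (ConvTrace i A B).conn S T → p ∉ T := fun T hT =>
      hend T (hP.conn_of_traceOf hc hS (hPt ▸ hT))
    rw [h] at hS
    obtain ⟨a, b, hab, c₀, hc₀, hca, hcb, hSc⟩ := hS
    have hpS : c₀.endSegAt p S := by
      rw [Curve.endSegAt_iff (hA.selfAvoiding hc₀)]
      exact ⟨hSc, hp, fun T hT => hend' T (Or.inl ⟨a, b, ⟨D, hD, hab⟩, c₀, hc₀, hca, hcb, hT⟩)⟩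
    have key : ∀ x y, s(x, y) ∈ D.segs → c₀.IsEndpt ((i : ℝ) • x) → p = (i : ℝ) • y →
        ∀ T, D.conn s(x, y) T → y ∉ T := by
      rintro x y hxy hx rfl T hT hy
      obtain ⟨d, rfl⟩ := Sym2.mem_iff_exists.1 hy
      obtain ⟨c', hc', h1, h2⟩ := hA.exists_joining (Curve.conn_mem_right hT)
      obtain ⟨S', hS'⟩ := Curve.isEndpt_iff.1 h1
      exact hend' S' (convTrace_conn_junction hD hT hc₀ hc' hx h2 hpS hS')
        (Curve.mem_of_endSegAt hS')
    rcases hA.eq_or_eq_of_isEndpt hc₀ hca hcb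
      (fun e => Curve.ne_of_mem_segs hab (hA.smul_inj.1 e)) (Curve.isEndpt_iff.2 ⟨S, hpS⟩)
      with e | e
    · refine ⟨a, e, s(a, b), hab, by simp, ?_⟩
      rw [Sym2.eq_swap] at hab ⊢
      exact key b a hab hcb e
    · exact ⟨b, e, s(a, b), hab, by simp, key a b hab hca e⟩
  · rintro ⟨q, rfl, U, hU, hq, hend⟩
    obtain ⟨a, rfl⟩ := Sym2.mem_iff_exists.1 hq
    obtain ⟨c₀, hc₀, h1, h2⟩ := hA.exists_joining hU
    obtain ⟨S, hS⟩ := Curve.isEndpt_iff.1 h1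
    have hSc := Curve.mem_segs_of_endSegAt hS
    refine ⟨S, h ▸ ⟨q, a, hU, c₀, hc₀, h1, h2, hSc⟩, Curve.mem_of_endSegAt hS,
      fun S' hS' hqS' => ?_⟩
    have hconn : (ConvTrace i A B).conn S S' := hPt ▸ ⟨c, hc, hS'⟩
    rcases convTrace_conn_cases hconn with
      ⟨c₁, hc₁, h⟩ | ⟨a₁, b₁, d₁, D₁, hD₁, h, c₁, hc₁, c₂, hc₂, g1, g2, g3, g4, g5, g6⟩
    · exact ((Curve.endSegAt_iff (hA.selfAvoiding hc₀)).1 hS).2.2 S'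
        (hA.disjSA.conn_of_traceOf hc₀ hSc ⟨c₁, hc₁, h⟩) hqS'
    · have hqa := Curve.ne_of_mem_segs hU
      have e := hA.pair_eq hc₀ hc₁ hSc (Curve.mem_segs_of_endSegAt g5) hqa
        (Curve.ne_of_mem_segs (Curve.conn_mem_left h)) h1 h2 g1 g2
      rcases Sym2.eq_iff.1 e with ⟨rfl, rfl⟩ | ⟨rfl, rfl⟩
      · -- the curve consists of the single segment `S`
        have hne : (i : ℝ) • q ≠ (i : ℝ) • a := fun e => hqa (hA.smul_inj.1 e)
        have eS := (Sym2.mem_and_mem_iff hne).1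
          ⟨Curve.mem_of_endSegAt hS, Curve.mem_of_endSegAt g5⟩
        have eS' := (Sym2.mem_and_mem_iff hne).1 ⟨hqS', Curve.mem_of_endSegAt g6⟩
        have e' := hA.pair_eq hc₁ hc₂ (Curve.mem_segs_of_endSegAt g5)
          (by rw [eS, ← eS']; exact Curve.mem_segs_of_endSegAt g6) hqa
          (Curve.ne_of_mem_segs (Curve.conn_mem_right h)) g1 g2 g3 g4
        rw [← e'] at h
        exact Curve.conn_irrefl (hB.selfAvoiding hD₁) h
      · rw [← e] at h
        exact hend _ (hB.disjSA.conn_of_traceOf hD hU ⟨D₁, hD₁, h⟩) (by simp)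

lemma convTrace_tr (hA : SatH A i j) (hB : SatH B k l) {t : Pt n} (ht : inLat j t)
    (ht' : inLat (i * l) t) :
    (∀ S ∈ (ConvTrace i A B).segs, tr t S ∈ (ConvTrace i A B).segs) ∧
    ∀ S S', (ConvTrace i A B).conn S S' → (ConvTrace i A B).conn (tr t S) (tr t S') := by
  obtain ⟨u, hu, rfl⟩ := ht'.exists_eq_smul
  have hinv := hB.2.2.2.2.2.2 u hu
  constructor
  · rintro S ⟨a, b, hab, c, hc, h1, h2, hS⟩
    obtain ⟨d, hd, hs, -, -, he⟩ := hA.exists_translate ht hc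
    exact ⟨a + u, b + u, tr_mem_segs_of_transl_eq hinv hab, d, hd,
      by simpa only [smul_add] using he _ h1, by simpa only [smul_add] using he _ h2, hs S hS⟩
  · rintro S S' (⟨a, b, hab, c, hc, h1, h2, hS⟩ | ⟨a, b, e, h, c, hc, c', hc', h1, h2, h3, h4, h5⟩)
    · obtain ⟨d, hd, -, hs, -, he⟩ := hA.exists_translate ht hc
      exact Or.inl ⟨a + u, b + u, tr_mem_segs_of_transl_eq hinv hab, d, hd,
        by simpa only [smul_add] using he _ h1, by simpa only [smul_add] using he _ h2, hs S S' hS⟩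
    · obtain ⟨d, hd, -, -, hs, he⟩ := hA.exists_translate ht hc
      obtain ⟨d', hd', -, -, hs', he'⟩ := hA.exists_translate ht hc'
      refine Or.inr ⟨a + u, b + u, e + u, conn_tr_of_transl_eq hinv h, d, hd, d', hd', ?_⟩
      simp only [smul_add]
      exact ⟨he _ h1, he _ h2, he' _ h3, he' _ h4,
        h5.imp (fun h => ⟨hs _ _ h.1, hs' _ _ h.2⟩) fun h => ⟨hs _ _ h.1, hs' _ _ h.2⟩⟩

lemma convTrace_transl (hA : SatH A i j) (hB : SatH B k l) {t : Pt n} (ht : inLat j t)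
    (ht' : inLat (i * l) t) : (ConvTrace i A B).transl t = ConvTrace i A B := by
  have h1 := convTrace_tr hA hB ht ht'
  have h2 := convTrace_tr hA hB ht.neg ht'.neg
  exact transl_eq_of_forall (fun S hS => ⟨h1.1 S hS, h2.1 S hS⟩)
    fun S S' h => ⟨h1.2 S S' h, h2.2 S S' h⟩

lemma exists_convSegs (hPt : traceOf P = ConvTrace i A B) (hc : c ∈ P) (hS : S ∈ c.segs) :
    ∃ D ∈ B, S ∈ convSegs i A D :=
  mem_convTrace_segs.1 (hPt ▸ ⟨c, hc, hS⟩)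

lemma exists_segs_eq_convSegs (hA : SatH A i j) (hB : SatH B k l) (hP : DisjSA P)
    (hPt : traceOf P = ConvTrace i A B) (hc : c ∈ P) : ∃ D ∈ B, c.segs = convSegs i A D := by
  obtain ⟨S, hS⟩ := c.segs_nonempty
  obtain ⟨D, hD, h⟩ := exists_convSegs hPt hc hS
  exact ⟨D, hD, segs_eq_convSegs hA hB hP hPt hc hD hS h⟩

lemma covers_of_traceOf_eq (hA : SatH A i j) (hB : SatH B k l) (hP : DisjSA P)
    (hPt : traceOf P = ConvTrace i A B) : Covers P Set.univ := by
  intro S hS _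
  refine ⟨?_, fun c hc d hd h h' => hP.sameCurve hc hd h h'⟩
  obtain ⟨c, hc, hSc⟩ := hA.exists_mem_segs hS
  obtain ⟨-, x, m, -, hx, h1, h2, -⟩ := hA.2.2.2.2.1 c hc
  obtain ⟨a, ha, rfl⟩ := inLat.exists_eq_smul (i := i) (m := 1) (by simpa using hx)
  obtain ⟨D, hD, hab⟩ := hB.exists_mem_segs ⟨a, m, ha.latt, rfl⟩
  rw [← smul_add] at h2
  have : S ∈ (traceOf P).segs := hPt ▸ ⟨a, a + uvec n m, ⟨D, hD, hab⟩, c, hc, h1, h2, hSc⟩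
  exact this

lemma satH_of_traceOf_eq_convTrace (hA : SatH A i j) (hB : SatH B k l) (hP : DisjSA P)
    (hPt : traceOf P = ConvTrace i A B) {L : ℕ} (hL : 0 < L) (hj : j ∣ L) (hl : i * l ∣ L) :
    SatH P (i * k) L := by
  refine ⟨Nat.mul_pos hA.1 hB.1, hL, (mul_dvd_mul_left i hB.2.2.1).trans hl,
    ⟨hP, covers_of_traceOf_eq hA hB hP hPt⟩, fun c hc => ?_, fun x m _ hx => ⟨?_, ?_⟩,
    fun t ht => ?_⟩
  · obtain ⟨D, hD, h⟩ := exists_segs_eq_convSegs hA hB hP hPt hc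
    have hend := @isEndpt_of_segs_eq _ _ _ _ _ _ _ _ _ _ hA hB hP hPt hc hD h
    obtain ⟨-, x, m, -, hx, h1, h2, h3⟩ := hB.2.2.2.2.1 D hD
    have e : (i : ℝ) • x + ((i * k : ℕ) : ℝ) • uvec n m = (i : ℝ) • (x + (k : ℝ) • uvec n m) := by
      rw [smul_add, smul_smul, Nat.cast_mul]
    have g1 : c.IsEndpt ((i : ℝ) • x) := hend.2 ⟨x, rfl, h1⟩
    have g2 : c.IsEndpt ((i : ℝ) • x + ((i * k : ℕ) : ℝ) • uvec n m) := hend.2 ⟨_, e, h2⟩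
    refine ⟨Curve.dom_finite_of_isEndpt g1 g2 ?_, (i : ℝ) • x, m, (hx.smul i).latt, hx.smul i,
      g1, g2, fun p hp => ?_⟩
    · simp [uvec_ne_zero, hA.1.ne', hB.1.ne']
    · obtain ⟨q, rfl, hq⟩ := hend.1 hp
      rw [e]
      exact (h3 q hq).imp (fun h => by rw [h]) fun h => by rw [h]
  · obtain ⟨y, hy, rfl⟩ := hx.exists_eq_smul
    obtain ⟨D, hD, h1, h2⟩ := (hB.2.2.2.2.2.1 y m hy.latt hy).1
    obtain ⟨S, hS⟩ := convSegs_nonempty hA D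
    have hSP : S ∈ (traceOf P).segs := hPt ▸ mem_convTrace_segs.2 ⟨D, hD, hS⟩
    obtain ⟨c, hc, hSc⟩ := hSP
    have h := segs_eq_convSegs hA hB hP hPt hc hD hSc hS
    refine ⟨c, hc, (isEndpt_of_segs_eq hA hB hP hPt hc hD h).2 ⟨y, rfl, h1⟩,
      (isEndpt_of_segs_eq hA hB hP hPt hc hD h).2 ⟨_, ?_, h2⟩⟩
    rw [smul_add, smul_smul, Nat.cast_mul]
  · intro c hc d hd hc1 hc2 hd1 hd2
    obtain ⟨y, hy, rfl⟩ := hx.exists_eq_smul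
    have e : (i : ℝ) • y + ((i * k : ℕ) : ℝ) • uvec n m = (i : ℝ) • (y + (k : ℝ) • uvec n m) := by
      rw [smul_add, smul_smul, Nat.cast_mul]
    rw [e] at hc2 hd2
    have descend : ∀ {c D q}, c ∈ P → D ∈ B → c.segs = convSegs i A D →
        c.IsEndpt ((i : ℝ) • q) → D.IsEndpt q := by
      intro c D q hc hD h hq
      obtain ⟨q', hq', h'⟩ := (isEndpt_of_segs_eq hA hB hP hPt hc hD h).1 hq
      rwa [hA.smul_inj.1 hq']
    obtain ⟨C, hC, h⟩ := exists_segs_eq_convSegs hA hB hP hPt hc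
    obtain ⟨D, hD, h'⟩ := exists_segs_eq_convSegs hA hB hP hPt hd
    have hs := (hB.2.2.2.2.2.1 y m hy.latt hy).2 C hC D hD (descend hc hC h hc1)
      (descend hc hC h hc2) (descend hd hD h' hd1) (descend hd hD h' hd2)
    have hcd : c.segs = d.segs := by rw [h, h', convSegs, convSegs, hs.1]
    obtain ⟨S, hS⟩ := c.segs_nonempty
    exact hP.sameCurve hc hd hS (hcd ▸ hS)
  · rw [hPt]
    exact convTrace_transl hA hB (ht.of_dvd hj) (ht.of_dvd hl)

end Conv

/-- if `𝒜` satisfies (H) for `(i,j)` and `ℬ` satisfies (H) for `(k,l)`,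
then `𝒜 ∗ ℬ` satisfies (H) for `(ik, lcm(j, i·l))`, and therefore satisfies (H) for
`(ik, j·l)`. -/
theorem statement1 {n : ℕ} (hn : 2 ≤ n) (A B : Set (Curve n)) (i j k l : ℕ)
    (hA : SatH A i j) (hB : SatH B k l) :
    ∀ P : Set (Curve n), DisjSA P → traceOf P = ConvTrace i A B →
      SatH P (i * k) (Nat.lcm j (i * l)) ∧ SatH P (i * k) (j * l) := by
  intro P hP hPt
  have hj : 0 < j := hA.2.1
  have hl : 0 < l := hB.2.1
  refine ⟨satH_of_traceOf_eq_convTrace hA hB hP hPt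
    (Nat.lcm_pos hj (Nat.mul_pos hA.1 hl)) (Nat.dvd_lcm_left _ _) (Nat.dvd_lcm_right _ _),
    satH_of_traceOf_eq_convTrace hA hB hP hPt (Nat.mul_pos hj hl) (Nat.dvd_mul_right _ _)
      (mul_dvd_mul_right hA.2.2.1 l)⟩

end
end Folding
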